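/- arXiv:1910.06992 — 2 statements merged into one kernel-verified Lean document; each statement's English description precedes it below -/
import Mathlib

section
/- Let n ≥ 2, β ∈ (0,1), α = 1 + β, and let u : ℝⁿ → ℝ be continuously differentiable on an open ball B_{R₀} centered at the origin. For 0 < R < R₀ define w_R(x) = (|x|/R)^α u(R x/|x|) for x ≠ 0 and w_R(0) = 0, and define A(R) = R^{-(n+2(α-1))} ∫_{B_R} |∇u|² dx − α ∫_{S^{n-1}} (u(Rθ)/R^α)² dθ. If for every R ∈ (0, R₀) one has ∫_{B_R} |∇u|² dx ≤ ∫_{B_R} |∇w_R|² dx, then A is a nondecreasing function of R on (0, R₀). -/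
open MeasureTheory Metric Set Filter
open scoped RealInnerProductSpace Topology Classical

noncomputable section

/-- Integral over the unit sphere `S^{n-1}` in `ℝⁿ` with its standard surface measure. -/
def sphInt (n : ℕ) (f : EuclideanSpace ℝ (Fin n) → ℝ) : ℝ :=
  ∫ θ : sphere (0 : EuclideanSpace ℝ (Fin n)) 1,
    f (θ : EuclideanSpace ℝ (Fin n)) ∂((volume : Measure (EuclideanSpace ℝ (Fin n))).toSphere)

/-- The Weiss-type monotonicity quantity
`A(R) = R^{-(n+2(α-1))} ∫_{B_R} |∇u|² - α ∫_{S^{n-1}} (u(Rθ)/R^α)²`. -/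
def Afun (n : ℕ) (α : ℝ) (u : EuclideanSpace ℝ (Fin n) → ℝ) (R : ℝ) : ℝ :=
  R ^ (-((n : ℝ) + 2 * (α - 1))) *
      (∫ x in ball (0 : EuclideanSpace ℝ (Fin n)) R, ‖gradient u x‖ ^ 2)
    - α * sphInt n (fun θ => (u (R • θ) / R ^ α) ^ 2)

/-- The α-homogeneous extension `w_R(x) = (|x|/R)^α u(R x/|x|)`, with `w_R 0 = 0`. -/
def homExt (n : ℕ) (α R : ℝ) (u : EuclideanSpace ℝ (Fin n) → ℝ)
    (x : EuclideanSpace ℝ (Fin n)) : ℝ :=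
  if x = 0 then 0 else (‖x‖ / R) ^ α * u ((R / ‖x‖) • x)

/-- The α-rescaling `u_R(x) = u(Rx)/R^α`. -/
def rescale (n : ℕ) (α : ℝ) (u : EuclideanSpace ℝ (Fin n) → ℝ) (R : ℝ)
    (x : EuclideanSpace ℝ (Fin n)) : ℝ :=
  u (R • x) / R ^ α

section PolarCoordinates

theorem indicator_ball_smul_sphere {E : Type*} [NormedAddCommGroup E] [NormedSpace ℝ E]
    (R : ℝ) (f : E → ℝ) (θ : sphere (0 : E) 1) (r : Ioi (0 : ℝ)) :
    (ball (0 : E) R).indicator f ((r : ℝ) • (θ : E)) =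
      (Iio R).indicator (fun s : ℝ => f (s • (θ : E))) r := by
  have hr : ‖(r : ℝ) • (θ : E)‖ = r := by
    rw [norm_smul, norm_eq_of_mem_sphere, mul_one, Real.norm_of_nonneg (mem_Ioi.1 r.2).le]
  by_cases h : (r : ℝ) < R
  · rw [indicator_of_mem (by rwa [mem_ball_zero_iff, hr]), indicator_of_mem (mem_Iio.2 h)]
  · rw [indicator_of_notMem (by rwa [mem_ball_zero_iff, hr]), indicator_of_notMem (by simpa using h)]

variable {E : Type*} [NormedAddCommGroup E] [NormedSpace ℝ E] [MeasurableSpace E] [BorelSpace E]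
  [FiniteDimensional ℝ E] [Nontrivial E] (μ : Measure E) [μ.IsAddHaarMeasure]

open Module Measure

theorem integral_eq_integral_toSphere_prod (f : E → ℝ) :
    ∫ x, f x ∂μ = ∫ p : sphere (0 : E) 1 × Ioi (0 : ℝ), f ((p.2 : ℝ) • (p.1 : E))
      ∂(μ.toSphere.prod (volumeIoiPow (finrank ℝ E - 1))) := by
  have h := μ.measurePreserving_homeomorphUnitSphereProd.integral_comp
    (Homeomorph.measurableEmbedding _)
    (fun p : sphere (0 : E) 1 × Ioi (0 : ℝ) => f ((p.2 : ℝ) • (p.1 : E)))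
  have h' : ∫ x, f x ∂μ = ∫ x : ({0}ᶜ : Set E), f x ∂(μ.comap (↑)) := by
    rw [integral_subtype_comap (measurableSet_singleton _).compl f, restrict_compl_singleton]
  rw [← h, h']
  congr 1 with x
  have hx : ‖(x : E)‖ ≠ 0 := norm_ne_zero_iff.2 (mem_compl_singleton_iff.1 x.2)
  simp [smul_smul, hx]

theorem integrable_toSphere_prod {f : E → ℝ} (hf : Integrable f μ) :
    Integrable (fun p : sphere (0 : E) 1 × Ioi (0 : ℝ) => f ((p.2 : ℝ) • (p.1 : E)))
      (μ.toSphere.prod (volumeIoiPow (finrank ℝ E - 1))) := by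
  refine (μ.measurePreserving_homeomorphUnitSphereProd.integrable_comp_emb
    (Homeomorph.measurableEmbedding _)).1 ?_
  rw [← restrict_compl_singleton (μ := μ) 0, ← IntegrableOn,
    integrableOn_iff_comap_subtypeVal (by measurability)] at hf
  refine hf.congr (.of_forall fun x => ?_)
  have hx : ‖(x : E)‖ ≠ 0 := norm_ne_zero_iff.2 (mem_compl_singleton_iff.1 x.2)
  simp [smul_smul, hx]

theorem integral_volumeIoiPow (m : ℕ) (g : ℝ → ℝ) :
    ∫ r : Ioi (0 : ℝ), g r ∂(volumeIoiPow m) = ∫ r in Ioi (0 : ℝ), r ^ m * g r := by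
  simp only [volumeIoiPow, ENNReal.ofReal]
  rw [integral_withDensity_eq_integral_smul,
    integral_subtype_comap measurableSet_Ioi fun a ↦ Real.toNNReal (a ^ m) • g a,
    setIntegral_congr_fun measurableSet_Ioi fun x hx ↦ ?_]
  · simp [NNReal.smul_def, Real.coe_toNNReal _ (pow_nonneg (mem_Ioi.1 hx).le _)]
  · exact (measurable_subtype_coe.pow_const _).real_toNNReal

theorem setIntegral_Ioi_indicator_Iio {R : ℝ} (hR : 0 ≤ R) (g : ℝ → ℝ) :
    ∫ r in Ioi (0 : ℝ), (Iio R).indicator g r = ∫ r in 0..R, g r := by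
  rw [setIntegral_indicator measurableSet_Iio, Ioi_inter_Iio, intervalIntegral.integral_of_le hR,
    integral_Ioc_eq_integral_Ioo]

theorem setIntegral_ball_eq_intervalIntegral_sphere {R : ℝ} (hR : 0 ≤ R) {f : E → ℝ}
    (hf : IntegrableOn f (ball 0 R) μ) :
    ∫ x in ball 0 R, f x ∂μ = ∫ r in 0..R, r ^ (finrank ℝ E - 1) *
      ∫ θ : sphere (0 : E) 1, f (r • (θ : E)) ∂μ.toSphere := by
  rw [← integral_indicator measurableSet_ball, integral_eq_integral_toSphere_prod,
    integral_prod_symm _ (integrable_toSphere_prod μ (hf.integrable_indicator measurableSet_ball)),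
    ← setIntegral_Ioi_indicator_Iio hR]
  simp only [indicator_ball_smul_sphere]
  rw [integral_volumeIoiPow _ (fun r => ∫ θ : sphere (0 : E) 1,
    (Iio R).indicator (fun s : ℝ => f (s • (θ : E))) r ∂μ.toSphere)]
  refine integral_congr_ae (.of_forall fun r => ?_)
  by_cases h : r < R <;> simp [h]

theorem setIntegral_ball_of_eq_mul {R : ℝ} (hR : 0 ≤ R) {f : E → ℝ} {h : ℝ → ℝ}
    {G : sphere (0 : E) 1 → ℝ}
    (hf : ∀ r ∈ Ioo 0 R, ∀ θ : sphere (0 : E) 1, f (r • (θ : E)) = G θ * h r) :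
    ∫ x in ball 0 R, f x ∂μ =
      (∫ θ, G θ ∂μ.toSphere) * ∫ r in 0..R, r ^ (finrank ℝ E - 1) * h r := by
  rw [← integral_indicator measurableSet_ball, integral_eq_integral_toSphere_prod,
    ← setIntegral_Ioi_indicator_Iio hR]
  have key : ∀ r : ℝ, (Iio R).indicator (fun r => r ^ (finrank ℝ E - 1) * h r) r =
      r ^ (finrank ℝ E - 1) * (Iio R).indicator h r := fun r => by
    by_cases hr : r < R <;> simp [hr]
  simp only [key]
  rw [← integral_volumeIoiPow, ← integral_prod_mul]
  refine integral_congr_ae (.of_forall fun p => ?_)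
  simp only [indicator_ball_smul_sphere]
  by_cases hr : (p.2 : ℝ) < R
  · simp [hr, hf _ ⟨p.2.2, hr⟩]
  · simp [hr]

end PolarCoordinates

section ParametricIntegral

variable {K : Type*} [TopologicalSpace K] [CompactSpace K]
  [MeasurableSpace K] [BorelSpace K] (μ : Measure K) [IsFiniteMeasure μ]

theorem hasDerivAt_integral_of_continuousOn {U : Set ℝ} (hU : IsOpen U) {F F' : ℝ → K → ℝ}
    (hF : ∀ r ∈ U, Continuous (F r)) (hF' : ContinuousOn F'.uncurry (U ×ˢ univ))
    (hd : ∀ r ∈ U, ∀ k, HasDerivAt (F · k) (F' r k) r) {r : ℝ} (hr : r ∈ U) :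
    HasDerivAt (fun r => ∫ k, F r k ∂μ) (∫ k, F' r k ∂μ) r := by
  obtain ⟨V, hV, hVU, hVc⟩ := local_compact_nhds (hU.mem_nhds hr)
  obtain ⟨C, hC⟩ := (hVc.prod isCompact_univ).exists_bound_of_continuousOn
    (hF'.mono (prod_mono_left hVU))
  have hcont : Continuous (F' r) :=
    hF'.comp_continuous (.prodMk_right r) fun _ => ⟨hr, mem_univ _⟩
  refine (hasDerivAt_integral_of_dominated_loc_of_deriv_le (bound := fun _ => C) hV ?_ ?_
    hcont.aestronglyMeasurable ?_ (integrable_const C) ?_).2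
  · filter_upwards [hU.mem_nhds hr] with s hs using (hF s hs).aestronglyMeasurable
  · exact (hF r hr).integrable_of_hasCompactSupport (HasCompactSupport.of_compactSpace _)
  · exact .of_forall fun k s hs => hC (s, k) ⟨hs, mem_univ _⟩
  · exact .of_forall fun k s hs => hd s (hVU hs) k

end ParametricIntegral

section HomogeneousExtension

theorem hasGradientAt_homExt {n : ℕ} {α R : ℝ} (hR : 0 < R) {u : EuclideanSpace ℝ (Fin n) → ℝ}
    {r : ℝ} (hr : 0 < r) {θ : EuclideanSpace ℝ (Fin n)} (hθ : ‖θ‖ = 1)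
    (hu : DifferentiableAt ℝ u (R • θ)) :
    HasGradientAt (homExt n α R u) ((r / R) ^ (α - 1) • ((α * u (R • θ) / R) • θ +
      (gradient u (R • θ) - ⟪gradient u (R • θ), θ⟫ • θ))) (r • θ) := by
  have hn : ‖r • θ‖ = r := by rw [norm_smul, hθ, mul_one, Real.norm_of_nonneg hr.le]
  have hx : r • θ ≠ 0 := norm_ne_zero_iff.1 (hn.trans_ne hr.ne')
  have hev : homExt n α R u =ᶠ[𝓝 (r • θ)]
      fun x => (‖x‖ / R) ^ α * u ((R / ‖x‖) • x) := by
    filter_upwards [isOpen_ne.mem_nhds hx] with x hx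
    simp only [homExt, if_neg hx]
  have hpt : (R / ‖r • θ‖) • (r • θ) = R • θ := by
    rw [hn, smul_smul, div_mul_cancel₀ _ hr.ne']
  have hnorm : HasFDerivAt (fun x : EuclideanSpace ℝ (Fin n) => ‖x‖) (innerSL ℝ θ) (r • θ) := by
    have h := (hasStrictFDerivAt_norm_sq (r • θ)).hasFDerivAt.sqrt (by simp [hn, hr.ne'])
    simp only [Real.sqrt_sq (norm_nonneg _)] at h
    refine h.congr_fderiv ?_
    ext v
    simp [hn]
    field_simp
  have hg := hu.hasGradientAt.hasFDerivAt
  rw [← hpt] at hg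
  have hpow := (hnorm.mul_const R⁻¹).rpow_const (p := α) (by left; rw [hn]; positivity)
  have hinv := ((hasDerivAt_inv (hn.trans_ne hr.ne')).comp_hasFDerivAt _ hnorm).const_mul R
  have hscal : HasFDerivAt (fun x : EuclideanSpace ℝ (Fin n) => (R / ‖x‖) • x) _ (r • θ) :=
    hinv.smul (hasFDerivAt_id (r • θ))
  have hcomp := HasFDerivAt.comp (f := fun x : EuclideanSpace ℝ (Fin n) => (R / ‖x‖) • x)
    (r • θ) hg hscal
  have := hpow.mul hcomp
  rw [hasGradientAt_iff_hasFDerivAt]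
  refine HasFDerivAt.congr_of_eventuallyEq ?_ hev
  refine this.congr_fderiv ?_
  ext v
  have hpow' : (r / R) ^ α = (r / R) ^ (α - 1) * (r / R) := by
    rw [← Real.rpow_add_one (by positivity)]; simp
  have hpt' : (R / r) • r • θ = R • θ := by rw [← hpt, hn]
  simp [hn, hpt']

  rw [← div_eq_mul_inv r R, hpow']
  field_simp
  ring

theorem norm_sq_gradient_homExt {n : ℕ} {α R : ℝ} (hR : 0 < R)
    {u : EuclideanSpace ℝ (Fin n) → ℝ}
    {r : ℝ} (hr : 0 < r) {θ : EuclideanSpace ℝ (Fin n)} (hθ : ‖θ‖ = 1)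
    (hu : DifferentiableAt ℝ u (R • θ)) :
    ‖gradient (homExt n α R u) (r • θ)‖ ^ 2 =
      (α ^ 2 / R ^ 2 * u (R • θ) ^ 2 + ‖gradient u (R • θ)‖ ^ 2 - ⟪gradient u (R • θ), θ⟫ ^ 2) *
      (r / R) ^ (2 * (α - 1)) := by
  rw [(hasGradientAt_homExt hR hr hθ hu).gradient, norm_smul, mul_pow, mul_comm]
  congr 1
  · rw [← real_inner_self_eq_norm_sq]
    simp only [inner_add_left, inner_add_right, inner_sub_left, inner_sub_right, inner_smul_left,
      inner_smul_right, real_inner_self_eq_norm_sq, hθ, real_inner_comm θ]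
    simp
    ring
  · rw [Real.norm_of_nonneg (by positivity), mul_comm 2, Real.rpow_mul (by positivity),
      Real.rpow_two]

end HomogeneousExtension

section MainTheorem

variable {n : ℕ} {R₀ : ℝ} {u : EuclideanSpace ℝ (Fin n) → ℝ}

theorem smul_sphere_mem_ball {E : Type*} [NormedAddCommGroup E] [NormedSpace ℝ E] {R₀ r : ℝ}
    (hr : r ∈ Ioo (-R₀) R₀) (θ : sphere (0 : E) 1) : r • (θ : E) ∈ ball (0 : E) R₀ := by
  rw [mem_ball_zero_iff, norm_smul, norm_eq_of_mem_sphere, mul_one]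
  exact abs_lt.2 hr

theorem continuousOn_comp_smul_sphere {E F : Type*} [NormedAddCommGroup E] [NormedSpace ℝ E]
    [TopologicalSpace F] {R₀ : ℝ} {f : E → F} (hf : ContinuousOn f (ball 0 R₀)) :
    ContinuousOn (fun p : ℝ × sphere (0 : E) 1 => f (p.1 • (p.2 : E)))
      (Ioo (-R₀) R₀ ×ˢ univ) :=
  hf.comp (by fun_prop) fun p hp => smul_sphere_mem_ball hp.1 p.2

theorem continuousOn_gradient (hu : ContDiffOn ℝ 1 u (ball 0 R₀)) :
    ContinuousOn (gradient u) (ball 0 R₀) :=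
  (InnerProductSpace.toDual ℝ _).symm.continuous.comp_continuousOn
    (hu.continuousOn_fderiv_of_isOpen isOpen_ball le_rfl)

theorem differentiableAt_of_contDiffOn_ball (hu : ContDiffOn ℝ 1 u (ball 0 R₀))
    {x : EuclideanSpace ℝ (Fin n)} (hx : x ∈ ball 0 R₀) : DifferentiableAt ℝ u x :=
  (hu.differentiableOn one_ne_zero).differentiableAt (isOpen_ball.mem_nhds hx)

theorem hasDerivAt_setIntegral_ball {E : Type*} [NormedAddCommGroup E] [NormedSpace ℝ E]
    [MeasurableSpace E] [BorelSpace E] [FiniteDimensional ℝ E] [Nontrivial E] (μ : Measure E)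
    [μ.IsAddHaarMeasure] {f : E → ℝ} {R₀ R : ℝ}
    (hf : ContinuousOn f (ball 0 R₀)) (hR : R ∈ Ioo 0 R₀) :
    HasDerivAt (fun R => ∫ x in ball 0 R, f x ∂μ) (R ^ (Module.finrank ℝ E - 1) *
      ∫ θ : sphere (0 : E) 1, f (R • (θ : E)) ∂μ.toSphere) R := by
  set g : ℝ → ℝ := fun r => r ^ (Module.finrank ℝ E - 1) *
    ∫ θ : sphere (0 : E) 1, f (r • (θ : E)) ∂μ.toSphere
  have hg : ContinuousOn g (Ioo (-R₀) R₀) := by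
    refine (by fun_prop : ContinuousOn (fun r : ℝ => r ^ (Module.finrank ℝ E - 1)) _).mul ?_
    exact continuousOn_integral_of_compact_support isCompact_univ
      (continuousOn_comp_smul_sphere hf) fun p x _ hx => absurd (mem_univ x) hx
  have hmem : R ∈ Ioo (-R₀) R₀ := ⟨by linarith [hR.1, hR.2], hR.2⟩
  have hnhds : Ioo (-R₀) R₀ ∈ 𝓝 R := isOpen_Ioo.mem_nhds hmem
  have hsub : uIcc 0 R ⊆ Ioo (-R₀) R₀ := by
    rw [uIcc_of_le hR.1.le]
    exact fun x hx => ⟨by linarith [hx.1, hR.1, hR.2], hx.2.trans_lt hR.2⟩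
  refine (intervalIntegral.integral_hasDerivAt_right (hg.mono hsub).intervalIntegrable
    (hg.stronglyMeasurableAtFilter isOpen_Ioo R hmem) (hg.continuousAt hnhds)).congr_of_eventuallyEq
    ?_
  filter_upwards [isOpen_Ioo.mem_nhds hR] with r hr
  refine setIntegral_ball_eq_intervalIntegral_sphere μ hr.1.le ?_
  exact ((hf.mono (closedBall_subset_ball hr.2)).integrableOn_compact
    (isCompact_closedBall 0 r)).mono_set ball_subset_closedBall

theorem hasDerivAt_integral_sphere_sq (hu : ContDiffOn ℝ 1 u (ball 0 R₀)) {R : ℝ}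
    (hR : R ∈ Ioo (-R₀) R₀) :
    HasDerivAt (fun R => sphInt n fun θ => u (R • θ) ^ 2)
      (sphInt n fun θ => 2 * (u (R • θ) * ⟪gradient u (R • θ), θ⟫)) R := by
  have hu' := continuousOn_comp_smul_sphere hu.continuousOn
  have hg := continuousOn_comp_smul_sphere (continuousOn_gradient hu)
  refine hasDerivAt_integral_of_continuousOn
    (F := fun R (θ : sphere (0 : EuclideanSpace ℝ (Fin n)) 1) => u (R • (θ : _)) ^ 2)
    (F' := fun R θ => 2 * (u (R • (θ : _)) * ⟪gradient u (R • (θ : _)), (θ : _)⟫))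
    _ isOpen_Ioo (fun r hr => ?_) ?_ (fun r hr θ => ?_) hR
  · exact (hu'.comp_continuous (.prodMk_right r) fun _ => ⟨hr, mem_univ _⟩).pow 2
  · exact continuousOn_const.mul (hu'.mul (hg.inner (by fun_prop)))
  · have h := (differentiableAt_of_contDiffOn_ball hu
      (smul_sphere_mem_ball hr θ)).hasGradientAt.hasFDerivAt
    have h1 : HasDerivAt (fun r : ℝ => r • (θ : EuclideanSpace ℝ (Fin n))) θ r := by
      simpa using (hasDerivAt_id r).smul_const (θ : EuclideanSpace ℝ (Fin n))
    have h2 := (h.comp_hasDerivAt r h1).pow 2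
    refine h2.congr_deriv ?_
    simp [mul_assoc]

theorem integral_rpow_scaled {n : ℕ} (hn : 1 ≤ n) {α R : ℝ} (hα : 1 ≤ α) (hR : 0 < R) :
    ∫ r in 0..R, r ^ (n - 1) * (r / R) ^ (2 * (α - 1)) = R ^ n / (n + 2 * (α - 1)) := by
  have hn' : (1 : ℝ) ≤ n := by exact_mod_cast hn
  have h1 : ∀ r ∈ uIcc 0 R, r ^ (n - 1) * (r / R) ^ (2 * (α - 1)) =
      (R ^ (2 * (α - 1)))⁻¹ * r ^ ((n : ℝ) - 1 + 2 * (α - 1)) := fun r hr => by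
    rw [uIcc_of_le hR.le] at hr
    rw [Real.div_rpow hr.1 hR.le, Real.rpow_add_of_nonneg hr.1 (by linarith) (by linarith),
      ← Real.rpow_natCast r (n - 1), Nat.cast_sub hn]
    push_cast
    ring
  rw [intervalIntegral.integral_congr h1, intervalIntegral.integral_const_mul,
    integral_rpow (Or.inl (by linarith)), Real.zero_rpow (by linarith),
    show (n : ℝ) - 1 + 2 * (α - 1) + 1 = n + 2 * (α - 1) by ring, Real.rpow_add hR,
    Real.rpow_natCast]
  field_simp
  ring

theorem setIntegral_ball_norm_sq_gradient_homExt (hn : 1 ≤ n)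
    (hu : ContDiffOn ℝ 1 u (ball 0 R₀)) {α R : ℝ} (hα : 1 ≤ α) (hR : R ∈ Ioo 0 R₀) :
    ∫ x in ball 0 R, ‖gradient (homExt n α R u) x‖ ^ 2 =
      (sphInt n fun θ => α ^ 2 / R ^ 2 * u (R • θ) ^ 2 + ‖gradient u (R • θ)‖ ^ 2 -
        ⟪gradient u (R • θ), θ⟫ ^ 2) * (R ^ n / (n + 2 * (α - 1))) := by
  have : Nontrivial (EuclideanSpace ℝ (Fin n)) :=
    Module.nontrivial_of_finrank_pos (R := ℝ) (by rw [finrank_euclideanSpace_fin]; omega)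
  rw [setIntegral_ball_of_eq_mul volume hR.1.le fun r hr θ =>
    norm_sq_gradient_homExt hR.1 hr.1 (norm_eq_of_mem_sphere θ)
      (differentiableAt_of_contDiffOn_ball hu
        (smul_sphere_mem_ball ⟨by linarith [hR.1, hR.2], hR.2⟩ θ)),
    finrank_euclideanSpace_fin, integral_rpow_scaled hn hα hR.1]
  rfl

theorem hasDerivAt_Afun (hn : 1 ≤ n) (hu : ContDiffOn ℝ 1 u (ball 0 R₀)) {α R : ℝ}
    (hR : R ∈ Ioo 0 R₀) :
    HasDerivAt (Afun n α u)
      (-(n + 2 * (α - 1)) * R ^ (-(n + 2 * (α - 1)) - 1) *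
          (∫ x in ball (0 : EuclideanSpace ℝ (Fin n)) R, ‖gradient u x‖ ^ 2) +
        R ^ (-(n + 2 * (α - 1))) * (R ^ (n - 1) * sphInt n fun θ => ‖gradient u (R • θ)‖ ^ 2) -
        α * (-(2 * α) * R ^ (-(2 * α) - 1) * (sphInt n fun θ => u (R • θ) ^ 2) +
          R ^ (-(2 * α)) * sphInt n fun θ => 2 * (u (R • θ) * ⟪gradient u (R • θ), θ⟫))) R := by
  have : Nontrivial (EuclideanSpace ℝ (Fin n)) :=
    Module.nontrivial_of_finrank_pos (R := ℝ) (by rw [finrank_euclideanSpace_fin]; omega)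
  have hD := hasDerivAt_setIntegral_ball volume ((continuousOn_gradient hu).norm.fun_pow 2) hR
  rw [finrank_euclideanSpace_fin] at hD
  have hI := hasDerivAt_integral_sphere_sq hu (R := R) ⟨by linarith [hR.1, hR.2], hR.2⟩
  have hp (c : ℝ) := Real.hasDerivAt_rpow_const (x := R) (p := c) (Or.inl hR.1.ne')
  refine (((hp _).mul hD).sub (((hp (-(2 * α))).mul hI).const_mul α)).congr_of_eventuallyEq ?_
  filter_upwards [isOpen_Ioo.mem_nhds hR] with r hr
  simp only [Afun, sphInt, Pi.sub_apply, Pi.mul_apply, div_pow, integral_div]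
  rw [Real.rpow_neg hr.1.le (2 * α), mul_comm 2 α, Real.rpow_mul hr.1.le, Real.rpow_two,
    div_eq_inv_mul]

theorem integrable_continuous_sphere {f : sphere (0 : EuclideanSpace ℝ (Fin n)) 1 → ℝ}
    (hf : Continuous f) :
    Integrable f (volume : Measure (EuclideanSpace ℝ (Fin n))).toSphere :=
  hf.integrable_of_hasCompactSupport (HasCompactSupport.of_compactSpace _)

theorem continuous_sphere_smul {F : Type*} [TopologicalSpace F] {f : EuclideanSpace ℝ (Fin n) → F}
    (hf : ContinuousOn f (ball 0 R₀)) {R : ℝ} (hR : R ∈ Ioo (-R₀) R₀) :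
    Continuous fun θ : sphere (0 : EuclideanSpace ℝ (Fin n)) 1 =>
      f (R • (θ : EuclideanSpace ℝ (Fin n))) :=
  (continuousOn_comp_smul_sphere hf).comp_continuous (.prodMk_right R) fun _ => ⟨hR, mem_univ _⟩

theorem sphInt_weiss_density (hu : ContDiffOn ℝ 1 u (ball 0 R₀)) {R : ℝ}
    (hR : R ∈ Ioo (-R₀) R₀) (c : ℝ) :
    (sphInt n fun θ => c * u (R • θ) ^ 2 + ‖gradient u (R • θ)‖ ^ 2 -
        ⟪gradient u (R • θ), θ⟫ ^ 2) =
      c * (sphInt n fun θ => u (R • θ) ^ 2) + (sphInt n fun θ => ‖gradient u (R • θ)‖ ^ 2) -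
        sphInt n fun θ => ⟪gradient u (R • θ), θ⟫ ^ 2 := by
  have hu' := continuous_sphere_smul hu.continuousOn hR
  have hg := continuous_sphere_smul (continuousOn_gradient hu) hR
  have i1 := integrable_continuous_sphere (hu'.fun_pow 2)
  have i2 := integrable_continuous_sphere (hg.norm.fun_pow 2)
  have i3 := integrable_continuous_sphere ((hg.inner (𝕜 := ℝ) continuous_subtype_val).fun_pow 2)
  simp only [sphInt]
  rw [integral_sub ((i1.const_mul c).fun_add i2) i3, integral_add (i1.const_mul c) i2,
    integral_const_mul]

theorem sphInt_radial_sq_nonneg (hu : ContDiffOn ℝ 1 u (ball 0 R₀)) {R : ℝ}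
    (hR : R ∈ Ioo (-R₀) R₀) (a b : ℝ) :
    0 ≤ a ^ 2 * (sphInt n fun θ => ⟪gradient u (R • θ), θ⟫ ^ 2) -
      a * b * (sphInt n fun θ => 2 * (u (R • θ) * ⟪gradient u (R • θ), θ⟫)) +
      b ^ 2 * sphInt n fun θ => u (R • θ) ^ 2 := by
  have hu' := continuous_sphere_smul hu.continuousOn hR
  have hg := continuous_sphere_smul (continuousOn_gradient hu) hR
  have hr := hg.inner (𝕜 := ℝ) continuous_subtype_val
  have i1 := integrable_continuous_sphere (hr.fun_pow 2)
  have i2 := integrable_continuous_sphere ((hu'.fun_mul hr).const_mul 2)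
  have i3 := integrable_continuous_sphere (hu'.fun_pow 2)
  have i12 := (i1.const_mul (a ^ 2)).sub (i2.const_mul (a * b))
  simp only [Pi.sub_def] at i12
  simp only [sphInt]
  rw [← integral_const_mul, ← integral_const_mul, ← integral_const_mul,
    ← integral_sub (i1.const_mul _) (i2.const_mul _), ← integral_add i12 (i3.const_mul _)]
  refine integral_nonneg fun θ => ?_
  convert sq_nonneg (a * ⟪gradient u (R • (θ : EuclideanSpace ℝ (Fin n))), (θ : _)⟫ -
    b * u (R • (θ : EuclideanSpace ℝ (Fin n)))) using 1
  simp only [Pi.zero_apply]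
  ring

end MainTheorem

/-- if `u` minimizes the Dirichlet energy against its α-homogeneous
extension on every ball `B_R ⊆ B_{R₀}`, then `A` is nondecreasing on `(0, R₀)`. -/
theorem monotonicity_of_A {n : ℕ} (hn : 2 ≤ n) {β α R₀ : ℝ}
    (hβ : β ∈ Set.Ioo (0 : ℝ) 1) (hα : α = 1 + β) (hR₀ : 0 < R₀)
    (u : EuclideanSpace ℝ (Fin n) → ℝ)
    (hu : ContDiffOn ℝ 1 u (ball (0 : EuclideanSpace ℝ (Fin n)) R₀))
    (hmin : ∀ R ∈ Set.Ioo (0 : ℝ) R₀,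
      (∫ x in ball (0 : EuclideanSpace ℝ (Fin n)) R, ‖gradient u x‖ ^ 2) ≤
        ∫ x in ball (0 : EuclideanSpace ℝ (Fin n)) R, ‖gradient (homExt n α R u) x‖ ^ 2) :
    MonotoneOn (Afun n α u) (Set.Ioo (0 : ℝ) R₀) := by
  have hn1 : 1 ≤ n := by omega
  have hα1 : 1 ≤ α := by linarith [hβ.1]
  have hder := fun R hR => hasDerivAt_Afun (α := α) (R := R) hn1 hu hR
  refine monotoneOn_of_deriv_nonneg (convex_Ioo 0 R₀)
    (fun R hR => (hder R hR).continuousAt.continuousWithinAt) ?_ ?_ <;> rw [interior_Ioo]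
  · exact fun R hR => (hder R hR).differentiableAt.differentiableWithinAt
  intro R hR
  have hR' : R ∈ Ioo (-R₀) R₀ := ⟨by linarith [hR.1], hR.2⟩
  rw [(hder R hR).deriv]
  have h := hmin R hR
  rw [setIntegral_ball_norm_sq_gradient_homExt hn1 hu hα1 hR] at h
  rw [sphInt_weiss_density hu hR'] at h
  have hsq := sphInt_radial_sq_nonneg hu hR' R α
  have hRpos := hR.1
  have hN : (0 : ℝ) < n + 2 * (α - 1) := by
    have : (1 : ℝ) ≤ n := by exact_mod_cast hn1
    linarith
  generalize (∫ x in ball (0 : EuclideanSpace ℝ (Fin n)) R, ‖gradient u x‖ ^ 2) = D at *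
  generalize (sphInt n fun θ => ‖gradient u (R • θ)‖ ^ 2) = P at *
  generalize (sphInt n fun θ => ⟪gradient u (R • θ), θ⟫ ^ 2) = Q at *
  generalize (sphInt n fun θ => 2 * (u (R • θ) * ⟪gradient u (R • θ), θ⟫)) = J at *
  generalize (sphInt n fun θ => u (R • θ) ^ 2) = I at *
  set T := R ^ (-(2 * α) - 1) with hT
  have hTpos : 0 < T := Real.rpow_pos_of_pos hRpos _
  have e1 : R ^ (-(2 * α)) = T * R := by
    rw [hT, ← Real.rpow_add_one hRpos.ne', sub_add_cancel]
  have e2 : R ^ (-(n + 2 * (α - 1))) * R ^ (n - 1) = T * R ^ 2 := by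
    rw [hT, ← Real.rpow_natCast, ← Real.rpow_natCast, ← Real.rpow_add hRpos,
      ← Real.rpow_add hRpos, Nat.cast_sub hn1]
    congr 1
    push_cast
    ring
  have e3 : R ^ (-(n + 2 * (α - 1)) - 1) * R ^ n = T * R ^ 2 := by
    rw [hT, ← Real.rpow_natCast, ← Real.rpow_natCast, ← Real.rpow_add hRpos,
      ← Real.rpow_add hRpos]
    congr 1
    push_cast
    ring
  have h3 : (n + 2 * (α - 1)) * R ^ (-(n + 2 * (α - 1)) - 1) * D ≤
      T * (α ^ 2 * I + R ^ 2 * P - R ^ 2 * Q) := by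
    calc _ ≤ (n + 2 * (α - 1)) * R ^ (-(n + 2 * (α - 1)) - 1) *
          ((α ^ 2 / R ^ 2 * I + P - Q) * (R ^ n / (n + 2 * (α - 1)))) := by gcongr
      _ = (R ^ (-(n + 2 * (α - 1)) - 1) * R ^ n) * (α ^ 2 / R ^ 2 * I + P - Q) := by
          field_simp
      _ = _ := by rw [e3]; field_simp
  rw [← mul_assoc, e1, e2]
  nlinarith [mul_nonneg hTpos.le hsq]
end
end

section
/- Let n ≥ 2, β ∈ (0,1), α = 1 + β, and let u : ℝⁿ → ℝ be continuously differentiable on an open ball B_{R₀} centered at the origin with u(0) = 0 and ∇u(0) = 0. Assume: (i) for every R ∈ (0, R₀), ∫_{B_R} |∇u|² dx ≤ ∫_{B_R} |∇w_R|² dx, where w_R(x) = (|x|/R)^α u(R x/|x|); (ii) the rescalings u_R(x) = u(Rx)/R^α, R ∈ (0, R₀/2), are uniformly bounded in C^{1,β} on every compact subset of ℝⁿ contained in their common domains (i.e., for every compact K there exist C > 0 and R_K > 0 with sup_K |u_R| + sup_K |∇u_R| + sup_{x≠y∈K} |∇u_R(x)−∇u_R(y)|/|x−y|^β ≤ C for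 all R < R_K); (iii) the quantity A(R) = R^{-(n+2(α-1))} ∫_{B_R} |∇u|² dx − α ∫_{S^{n-1}} (u(Rθ)/R^α)² dθ is nondecreasing on (0, R₀) and satisfies, for 0 < s₁ < s₂ and small R, A(s₂R) − A(s₁R) ≥ ∫_{s₁}^{s₂} ρ^{-(1+2(α−1))} [ ∫_{S^{n-1}} (∂_ν u_R(ρθ) − α u_R(ρθ)/ρ)² dθ ] dρ. Then for every sequence R_i ↓ 0 there exists a subsequence R_{i_m} such that u_{R_{i_m}} converges, together with its gradient, locally uniformly on ℝⁿ to a function u₀, and u₀ is either a homogeneous function of degree α (u₀(tx) = t^α u₀(x) for all x and t > 0) or u₀ ≡ 0. -/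
open MeasureTheory Metric Set Filter
open scoped RealInnerProductSpace Topology Classical

noncomputable section

/-- A sequence of maps which is pointwise bounded and asymptotically equicontinuous has a
locally uniformly convergent subsequence. -/
theorem exists_subseq_tendstoLocallyUniformly {X Y : Type*} [PseudoMetricSpace X]
    [TopologicalSpace.SeparableSpace X] [MetricSpace Y] [ProperSpace Y] {f : ℕ → X → Y}
    (hbdd : ∀ x, Bornology.IsBounded (range fun k => f k x))
    (hequi : ∀ x, ∀ ε > 0, ∃ δ > 0, ∀ᶠ k in atTop, ∀ y ∈ ball x δ, dist (f k y) (f k x) < ε) :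
    ∃ σ : ℕ → ℕ, StrictMono σ ∧ ∃ g : X → Y, Continuous g ∧
      TendstoLocallyUniformly (fun k => f (σ k)) g atTop := by
  obtain ⟨D, hDc, hDd⟩ := TopologicalSpace.exists_countable_dense X
  have : Countable D := hDc.to_subtype
  obtain ⟨a, -, σ, hσ, ha⟩ := (isCompact_pi_infinite fun d : D =>
      (hbdd d).isCompact_closure).tendsto_subseq (x := fun k (d : D) => f k d)
      (fun k d => subset_closure (mem_range_self k))
  have ha' : ∀ d : D, Tendsto (fun k => f (σ k) d) atTop (𝓝 (a d)) := tendsto_pi_nhds.1 ha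
  have hlim : ∀ x, ∃ y, Tendsto (fun k => f (σ k) x) atTop (𝓝 y) := by
    intro x
    apply cauchySeq_tendsto_of_complete
    rw [Metric.cauchySeq_iff']
    intro ε hε
    obtain ⟨δ, hδ, hk⟩ := hequi x (ε / 4) (by positivity)
    obtain ⟨d, hdx, hdD⟩ := hDd.exists_mem_open isOpen_ball ⟨x, mem_ball_self hδ⟩
    have h1 := hσ.tendsto_atTop.eventually hk
    have h2 := Metric.tendsto_nhds.1 (ha' ⟨d, hdx⟩) (ε / 4) (by positivity)
    obtain ⟨N, hN⟩ := eventually_atTop.1 (h1.and h2)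
    refine ⟨N, fun m hm => ?_⟩
    have m1 := (hN m hm).1 d hdD
    have m2 := (hN m hm).2
    have n1 := (hN N le_rfl).1 d hdD
    have n2 := (hN N le_rfl).2
    have t1 := dist_triangle4 (f (σ m) x) (f (σ m) d) (a ⟨d, hdx⟩) (f (σ N) x)
    have t2 := dist_triangle (a ⟨d, hdx⟩) (f (σ N) d) (f (σ N) x)
    rw [dist_comm] at m1
    rw [dist_comm] at n2
    linarith
  choose g hg using hlim
  have hkey : ∀ x, ∀ ε > 0, ∃ δ > 0, (∀ y ∈ ball x δ, dist (g y) (g x) ≤ ε) ∧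
      ∀ᶠ k in atTop, ∀ y ∈ ball x δ, dist (f (σ k) y) (f (σ k) x) < ε := by
    intro x ε hε
    obtain ⟨δ, hδ, hk⟩ := hequi x ε hε
    have hk' := hσ.tendsto_atTop.eventually hk
    exact ⟨δ, hδ, fun y hy => le_of_tendsto ((hg y).dist (hg x))
      (hk'.mono fun m hm => (hm y hy).le), hk'⟩
  refine ⟨σ, hσ, g, Metric.continuous_iff.2 fun x ε hε => ?_,
    Metric.tendstoLocallyUniformly_iff.2 fun ε hε x => ?_⟩
  · obtain ⟨δ, hδ, h, -⟩ := hkey x (ε / 2) (by positivity)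
    exact ⟨δ, hδ, fun y hy => (h y hy).trans_lt (by linarith)⟩
  · obtain ⟨δ, hδ, h, hk⟩ := hkey x (ε / 4) (by positivity)
    refine ⟨ball x δ, ball_mem_nhds x hδ, ?_⟩
    filter_upwards [hk, Metric.tendsto_nhds.1 (hg x) (ε / 4) (by positivity)] with k h1 h2 y hy
    have h3 := h y hy
    have h4 := h1 y hy
    have t1 := dist_triangle4 (g y) (g x) (f (σ k) x) (f (σ k) y)
    rw [dist_comm] at h2 h4
    linarith

/-- A nonnegative continuous function that is at least `c` on `[a, b] × V` has iterated integral
at least `(b - a) * (c * μ V)`. -/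
theorem mul_measureReal_le_intervalIntegral_integral {S : Type*} [TopologicalSpace S]
    [CompactSpace S] [SecondCountableTopology S] [MeasurableSpace S] [BorelSpace S]
    (μ : Measure S) [IsFiniteMeasure μ]
    {ψ : ℝ → S → ℝ} {a b c : ℝ} (hab : a ≤ b) {V : Set S}
    (hψ : ContinuousOn (Function.uncurry ψ) (Icc a b ×ˢ univ)) (hnonneg : ∀ ρ ∈ Icc a b, 0 ≤ ψ ρ)
    (hc : 0 ≤ c) (hV : ∀ ρ ∈ Icc a b, ∀ θ ∈ V, c ≤ ψ ρ θ) :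
    (b - a) * (c * μ.real V) ≤ ∫ ρ in a..b, ∫ θ, ψ ρ θ ∂μ := by
  set φ : ℝ → S → ℝ := fun ρ => ψ (projIcc a b hab ρ) with hφ
  have hφc : Continuous (Function.uncurry φ) := by
    refine hψ.comp_continuous
      (f := fun p : ℝ × S => ((projIcc a b hab p.1 : ℝ), p.2)) ?_ fun p => ⟨?_, mem_univ _⟩
    · exact (continuous_subtype_val.comp (continuous_projIcc.comp continuous_fst)).prodMk
        continuous_snd
    · exact (projIcc a b hab p.1).2
  have hint : ∀ ρ, Integrable (φ ρ) μ := fun ρ =>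
    (show Continuous (φ ρ) from hφc.comp (Continuous.prodMk_right ρ)).integrable_of_hasCompactSupport
      (HasCompactSupport.of_compactSpace _)
  have hφI : Continuous fun ρ => ∫ θ, φ ρ θ ∂μ := by
    simpa using continuous_parametric_integral_of_continuous (μ := μ) hφc isCompact_univ
  have hlow : ∀ ρ, c * μ.real V ≤ ∫ θ, φ ρ θ ∂μ := fun ρ =>
    (mul_le_mul_of_nonneg_left (measureReal_mono fun θ hθ => hV _ (projIcc a b hab ρ).2 θ hθ)
      hc).trans (mul_meas_ge_le_integral_of_nonneg
        (ae_of_all _ (hnonneg _ (projIcc a b hab ρ).2)) (hint ρ) c)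
  have hcongr : ∫ ρ in a..b, ∫ θ, ψ ρ θ ∂μ = ∫ ρ in a..b, ∫ θ, φ ρ θ ∂μ := by
    refine intervalIntegral.integral_congr fun ρ hρ => ?_
    rw [uIcc_of_le hab] at hρ
    simp only [hφ, projIcc_of_mem hab hρ]
  rw [hcongr]
  calc (b - a) * (c * μ.real V) = ∫ _ in a..b, c * μ.real V := by
        rw [intervalIntegral.integral_const, smul_eq_mul]
    _ ≤ _ := intervalIntegral.integral_mono_on hab intervalIntegrable_const
        (hφI.intervalIntegrable a b) fun ρ _ => hlow ρ

/-- Euler's relation `⟪∇ f x, x⟫ = α f x` away from the origin implies homogeneity of degree `α`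
away from the origin. -/
theorem homogeneous_of_inner_gradient_eq {E : Type*} [NormedAddCommGroup E] [InnerProductSpace ℝ E]
    [CompleteSpace E] {f : E → ℝ} {g : E → E} {α : ℝ} (hf : ∀ x, HasGradientAt f (g x) x)
    (heuler : ∀ x, x ≠ 0 → ⟪g x, x⟫ = α * f x) {x : E} (hx : x ≠ 0) {t : ℝ} (ht : 0 < t) :
    f (t • x) = t ^ α * f x := by
  have hd : ∀ s ∈ Ioi (0 : ℝ), HasDerivAt (fun s : ℝ => f (s • x) * s ^ (-α)) 0 s := by
    intro s hs
    have hs0 : s ≠ 0 := (ne_of_gt hs)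
    have h1 : HasDerivAt (fun s : ℝ => f (s • x)) ⟪g (s • x), x⟫ s := by
      have h := (hf (s • x)).hasFDerivAt.comp_hasDerivAt s ((hasDerivAt_id s).smul_const x)
      rw [one_smul, InnerProductSpace.toDual_apply_apply] at h
      exact h
    have h2 := h1.mul (Real.hasDerivAt_rpow_const (p := -α) (Or.inl hs0))
    refine h2.congr_deriv ?_
    have h3 := heuler (s • x) (smul_ne_zero hs0 hx)
    rw [inner_smul_right] at h3
    have h4 : (s : ℝ) ^ (-α) = s * s ^ (-α - 1) := by
      rw [Real.rpow_sub_one hs0]; field_simp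
    rw [h4]
    linear_combination (s ^ (-α - 1)) * h3
  have hconst := isOpen_Ioi.is_const_of_deriv_eq_zero isPreconnected_Ioi
    (fun s hs => (hd s hs).differentiableAt.differentiableWithinAt) (fun s hs => (hd s hs).deriv)
    (mem_Ioi.2 ht) (mem_Ioi.2 one_pos)
  simp only [one_smul, Real.one_rpow, mul_one] at hconst
  rw [← hconst, Real.rpow_neg ht.le]
  have := (Real.rpow_pos_of_pos ht α).ne'
  field_simp

theorem differentiableAt_rescale {n : ℕ} {α R₀ R : ℝ} {u : EuclideanSpace ℝ (Fin n) → ℝ}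
    (hu : DifferentiableOn ℝ u (ball 0 R₀)) (hR : 0 < R) {x : EuclideanSpace ℝ (Fin n)}
    (hx : R * ‖x‖ < R₀) : DifferentiableAt ℝ (rescale n α u R) x := by
  have hmem : R • x ∈ ball (0 : EuclideanSpace ℝ (Fin n)) R₀ := by
    simpa [norm_smul, abs_of_pos hR] using hx
  have h1 : DifferentiableAt ℝ u (R • x) := hu.differentiableAt (isOpen_ball.mem_nhds hmem)
  have h2 : DifferentiableAt ℝ (fun y => u (R • y)) x :=
    h1.comp x (differentiableAt_id.const_smul R)
  unfold rescale
  simpa only [div_eq_mul_inv] using h2.mul_const (R ^ α)⁻¹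

/-- A lower bound near the right of `0` for the Weiss-type quantity in terms of a bound of the
rescaling on the unit sphere. -/
theorem neg_le_Afun {n : ℕ} {α C R : ℝ} (hα : 0 ≤ α) {u : EuclideanSpace ℝ (Fin n) → ℝ}
    (hR : 0 < R) (hC : ∀ x ∈ closedBall (0 : EuclideanSpace ℝ (Fin n)) 1, |rescale n α u R x| ≤ C) :
    -(α * (C ^ 2 * (volume : Measure (EuclideanSpace ℝ (Fin n))).toSphere.real univ)) ≤
      Afun n α u R := by
  have h1 : 0 ≤ R ^ (-((n : ℝ) + 2 * (α - 1))) *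
      (∫ x in ball (0 : EuclideanSpace ℝ (Fin n)) R, ‖gradient u x‖ ^ 2) :=
    mul_nonneg (Real.rpow_nonneg hR.le _) (integral_nonneg fun _ => by positivity)
  have h2 : sphInt n (fun θ => (u (R • θ) / R ^ α) ^ 2) ≤
      C ^ 2 * (volume : Measure (EuclideanSpace ℝ (Fin n))).toSphere.real univ := by
    unfold sphInt
    refine (Real.le_norm_self _).trans (norm_integral_le_of_norm_le_const (ae_of_all _ fun θ => ?_))
    rw [norm_pow, Real.norm_eq_abs]
    exact pow_le_pow_left₀ (abs_nonneg _) (hC θ (sphere_subset_closedBall θ.2)) 2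
  have h3 := mul_le_mul_of_nonneg_left h2 hα
  unfold Afun
  linarith

/-- A monotone function on `(0, r)` that is bounded below near `0` has vanishing increments
along dilations of a sequence decreasing to `0`. -/
theorem MonotoneOn.tendsto_sub_comp_mul {A : ℝ → ℝ} {r r' M : ℝ} (hr : 0 < r)
    (hA : MonotoneOn A (Ioo 0 r)) (hr' : 0 < r') (hM : ∀ s ∈ Ioo 0 r', M ≤ A s)
    {R : ℕ → ℝ} (hR : ∀ k, 0 < R k) (hR0 : Tendsto R atTop (𝓝 0)) {s t : ℝ} (hs : 0 < s)
    (ht : 0 < t) : Tendsto (fun k => A (t * R k) - A (s * R k)) atTop (𝓝 0) := by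
  have hbdd : BddBelow (A '' Ioo 0 r) := by
    refine ⟨M, ?_⟩
    rintro _ ⟨s, hs, rfl⟩
    have hm : 0 < min s (r' / 2) := lt_min hs.1 (by positivity)
    have hm1 := min_le_left s (r' / 2)
    have hm2 := min_le_right s (r' / 2)
    exact (hM _ ⟨hm, by linarith⟩).trans (hA ⟨hm, by linarith [hs.2]⟩ hs hm1)
  have hlim := hA.tendsto_nhdsWithin_Ioo_right (nonempty_Ioo.2 hr) hbdd
  have hdil : ∀ q : ℝ, 0 < q → Tendsto (fun k => q * R k) atTop (𝓝[>] 0) := fun q hq =>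
    tendsto_nhdsWithin_iff.2 ⟨by simpa using hR0.const_mul q,
      Eventually.of_forall fun k => mul_pos hq (hR k)⟩
  simpa using (hlim.comp (hdil t ht)).sub (hlim.comp (hdil s hs))

theorem norm_gradient {E : Type*} [NormedAddCommGroup E] [InnerProductSpace ℝ E]
    [CompleteSpace E] (f : E → ℝ) (x : E) : ‖gradient f x‖ = ‖fderiv ℝ f x‖ := by
  rw [← toDual_gradient, LinearIsometryEquiv.norm_map]

theorem continuousOn_of_norm_sub_le_mul_rpow {E F : Type*} [SeminormedAddCommGroup E]
    [SeminormedAddCommGroup F] {f : E → F} {K : Set E} {C β : ℝ} (hβ : 0 < β)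
    (hf : ∀ x ∈ K, ∀ y ∈ K, ‖f x - f y‖ ≤ C * ‖x - y‖ ^ β) : ContinuousOn f K := by
  intro x hx
  rw [ContinuousWithinAt, tendsto_iff_norm_sub_tendsto_zero]
  have h : Tendsto (fun y => C * ‖y - x‖ ^ β) (𝓝[K] x) (𝓝 0) := by
    have h1 : Continuous fun y : E => C * ‖y - x‖ ^ β :=
      continuous_const.mul ((continuous_id.sub continuous_const).norm.rpow_const
        fun _ => Or.inr hβ.le)
    simpa [Real.zero_rpow hβ.ne'] using (h1.tendsto x).mono_left nhdsWithin_le_nhds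
  exact squeeze_zero' (Eventually.of_forall fun _ => norm_nonneg _)
    (eventually_mem_nhdsWithin.mono fun y hy => hf y hy x hx) h

/-- If the values and gradients of a sequence are, on each ball, eventually bounded, with
gradients eventually uniformly Hölder continuous, then a subsequence converges in `C¹_loc`. -/
theorem exists_subseq_tendstoLocallyUniformly_gradient {E : Type*} [NormedAddCommGroup E]
    [InnerProductSpace ℝ E] [FiniteDimensional ℝ E] {β : ℝ} (hβ : 0 < β) {v : ℕ → E → ℝ}
    (hv : ∀ r : ℝ, ∃ C : ℝ, ∀ᶠ k in atTop, ∀ x ∈ closedBall (0 : E) r,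
      DifferentiableAt ℝ (v k) x ∧ |v k x| ≤ C ∧ ‖gradient (v k) x‖ ≤ C ∧
      ∀ y ∈ closedBall (0 : E) r, ‖gradient (v k) x - gradient (v k) y‖ ≤ C * ‖x - y‖ ^ β) :
    ∃ σ : ℕ → ℕ, StrictMono σ ∧ ∃ v₀ : E → ℝ, Continuous v₀ ∧ Continuous (gradient v₀) ∧
      Differentiable ℝ v₀ ∧
      TendstoLocallyUniformly (fun m => v (σ m)) v₀ atTop ∧
      TendstoLocallyUniformly (fun m => gradient (v (σ m))) (gradient v₀) atTop := by
  have hbdd : ∀ x, Bornology.IsBounded (range fun k => (v k x, gradient (v k) x)) := by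
    intro x
    obtain ⟨C, hC⟩ := hv ‖x‖
    obtain ⟨N, hN⟩ := eventually_atTop.1 hC
    refine (((finite_Iio N).image fun k => (v k x, gradient (v k) x)).isBounded.union
      (isBounded_closedBall (x := 0) (r := C))).subset ?_
    rintro _ ⟨k, rfl⟩
    rcases lt_or_ge k N with hk | hk
    · exact Or.inl ⟨k, hk, rfl⟩
    · obtain ⟨-, h1, h2, -⟩ := hN k hk x (by simp)
      exact Or.inr (mem_closedBall_zero_iff.2 (max_le h1 h2))
  have hequi : ∀ x, ∀ ε > 0, ∃ δ > 0, ∀ᶠ k in atTop, ∀ y ∈ ball x δ,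
      dist (v k y, gradient (v k) y) (v k x, gradient (v k) x) < ε := by
    intro x ε hε
    obtain ⟨C, hC⟩ := hv (‖x‖ + 1)
    have h1 : Tendsto (fun y => C * ‖y - x‖) (𝓝 x) (𝓝 0) := by
      have : Continuous fun y : E => C * ‖y - x‖ := by fun_prop
      simpa using this.tendsto x
    have h2 : Tendsto (fun y => C * ‖y - x‖ ^ β) (𝓝 x) (𝓝 0) := by
      have : Continuous fun y : E => C * ‖y - x‖ ^ β :=
        continuous_const.mul ((continuous_id.sub continuous_const).norm.rpow_const
          fun _ => Or.inr hβ.le)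
      simpa [Real.zero_rpow hβ.ne'] using this.tendsto x
    obtain ⟨δ, hδ, h⟩ := Metric.eventually_nhds_iff_ball.1
      (((h1.eventually_lt_const hε).and (h2.eventually_lt_const hε)).and
        (ball_mem_nhds x one_pos))
    refine ⟨δ, hδ, ?_⟩
    filter_upwards [hC] with k hk y hy
    obtain ⟨⟨hy1, hy2⟩, hy3⟩ := h y hy
    have hx' : x ∈ closedBall (0 : E) (‖x‖ + 1) := by simp
    have hy' : y ∈ closedBall (0 : E) (‖x‖ + 1) := by
      have := norm_le_norm_add_norm_sub' y x
      rw [dist_eq_norm] at hy3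
      rw [mem_closedBall_zero_iff]
      linarith
    rw [Prod.dist_eq, max_lt_iff, dist_eq_norm, dist_eq_norm]
    refine ⟨((convex_closedBall _ _).norm_image_sub_le_of_norm_fderiv_le (𝕜 := ℝ)
      (fun z hz => (hk z hz).1) (fun z hz => ?_) hx' hy').trans_lt hy1,
      ((hk y hy').2.2.2 x hx').trans_lt hy2⟩
    rw [← norm_gradient]
    exact (hk z hz).2.2.1
  obtain ⟨σ, hσ, g, hgc, hg⟩ := exists_subseq_tendstoLocallyUniformly hbdd hequi
  have hg1 : TendstoLocallyUniformly (fun m => v (σ m)) (Prod.fst ∘ g) atTop :=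
    uniformContinuous_fst.comp_tendstoLocallyUniformly hg
  have hg2 : TendstoLocallyUniformly (fun m => gradient (v (σ m))) (Prod.snd ∘ g) atTop :=
    uniformContinuous_snd.comp_tendstoLocallyUniformly hg
  have hgrad : ∀ x, HasGradientAt (Prod.fst ∘ g) ((Prod.snd ∘ g) x) x := by
    intro x
    rw [hasGradientAt_iff_hasFDerivAt]
    refine hasFDerivAt_of_tendstoUniformlyOnFilter (l := atTop) (f := fun m => v (σ m))
      (f' := fun m y => InnerProductSpace.toDual ℝ E (gradient (v (σ m)) y))
      (g' := fun y => InnerProductSpace.toDual ℝ E ((Prod.snd ∘ g) y)) ?_ ?_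
      (Eventually.of_forall fun y => hg1.tendstoLocallyUniformlyOn.tendsto_at (mem_univ y))
    · exact (InnerProductSpace.toDual ℝ E).isometry.uniformContinuous.comp_tendstoUniformlyOnFilter
        (tendstoLocallyUniformly_iff_filter.1 hg2 x)
    · obtain ⟨C, hC⟩ := hv (‖x‖ + 1)
      have h1 := (tendsto_fst (f := atTop) (g := 𝓝 x)).eventually (hσ.tendsto_atTop.eventually hC)

      have h2 : ∀ᶠ n : ℕ × E in atTop ×ˢ 𝓝 x, n.2 ∈ closedBall (0 : E) (‖x‖ + 1) :=
        tendsto_snd.eventually (closedBall_mem_nhds_of_mem (by simp))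
      filter_upwards [h1, h2] with p hp hp2
      exact (hp _ hp2).1.hasGradientAt.hasFDerivAt
  have hgeq : gradient (Prod.fst ∘ g) = Prod.snd ∘ g := gradient_eq hgrad
  refine ⟨σ, hσ, Prod.fst ∘ g, continuous_fst.comp hgc, ?_,
    fun x => (hgrad x).differentiableAt, hg1, ?_⟩
  · rw [hgeq]; exact continuous_snd.comp hgc
  · rw [hgeq]; exact hg2

theorem TendstoLocallyUniformly.tendsto_prod {ι X Y : Type*} [TopologicalSpace X] [UniformSpace Y]
    {F : ι → X → Y} {f : X → Y} {l : Filter ι} (h : TendstoLocallyUniformly F f l) {x : X}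
    (hf : ContinuousAt f x) : Tendsto (fun p : ι × X => F p.1 p.2) (l ×ˢ 𝓝 x) (𝓝 (f x)) :=
  tendsto_comp_of_locally_uniform_limit (F := fun p : ι × X => F p.1) hf tendsto_snd fun V hV =>
    let ⟨t, ht, hVt⟩ := h V hV x
    ⟨t, ht, tendsto_fst.eventually hVt⟩

/-- If the weighted spherical defects of homogeneity of a `C¹_loc`-convergent sequence vanish
asymptotically, then the limit satisfies Euler's relation away from the origin. -/
theorem inner_gradient_eq_of_tendsto_defect {n : ℕ} {α γ : ℝ}
    {v : ℕ → EuclideanSpace ℝ (Fin n) → ℝ} {v₀ : EuclideanSpace ℝ (Fin n) → ℝ}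
    (hv : TendstoLocallyUniformly v v₀ atTop)
    (hgrad : TendstoLocallyUniformly (fun m => gradient (v m)) (gradient v₀) atTop)
    (hv₀ : Continuous v₀) (hgrad₀ : Continuous (gradient v₀))
    (hcont : ∀ r : ℝ, ∀ᶠ m in atTop, ContinuousOn (v m) (closedBall 0 r) ∧
      ContinuousOn (gradient (v m)) (closedBall 0 r))
    (hdefect : ∀ s t : ℝ, 0 < s → s < t → ∀ ε > 0, ∀ᶠ m in atTop,
      (∫ ρ in s..t, ρ ^ γ * sphInt n (fun θ =>
        (⟪gradient (v m) (ρ • θ), θ⟫ - α * v m (ρ • θ) / ρ) ^ 2)) < ε)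
    {x : EuclideanSpace ℝ (Fin n)} (hx : x ≠ 0) : ⟪gradient v₀ x, x⟫ = α * v₀ x := by
  by_contra hne
  have hr : 0 < ‖x‖ := norm_pos_iff.2 hx
  let θ₀ : sphere (0 : EuclideanSpace ℝ (Fin n)) 1 :=
    ⟨‖x‖⁻¹ • x, by simp [norm_smul, hr.ne']⟩
  have hrθ : ‖x‖ • (θ₀ : EuclideanSpace ℝ (Fin n)) = x := smul_inv_smul₀ hr.ne' x
  let ψ : ℕ → ℝ → sphere (0 : EuclideanSpace ℝ (Fin n)) 1 → ℝ := fun m ρ θ =>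
    ρ ^ γ * (⟪gradient (v m) (ρ • (θ : EuclideanSpace ℝ (Fin n))), θ⟫ -
      α * v m (ρ • (θ : EuclideanSpace ℝ (Fin n))) / ρ) ^ 2
  set L : ℝ := ‖x‖ ^ γ * (⟪gradient v₀ x, θ₀⟫ - α * v₀ x / ‖x‖) ^ 2 with hL
  have hLpos : 0 < L := by
    refine mul_pos (Real.rpow_pos_of_pos hr _) (sq_pos_of_ne_zero fun h => hne ?_)
    have h1 : ⟪gradient v₀ x, x⟫ = ‖x‖ * ⟪gradient v₀ x, θ₀⟫ := by
      rw [← inner_smul_right, hrθ]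
    rw [h1, sub_eq_zero.1 h]
    field_simp
  have hlim : Tendsto (fun p : ℕ × ℝ × sphere (0 : EuclideanSpace ℝ (Fin n)) 1 =>
      ψ p.1 p.2.1 p.2.2) (atTop ×ˢ 𝓝 (‖x‖, θ₀)) (𝓝 L) := by
    have hρ : Tendsto (fun p : ℕ × ℝ × sphere (0 : EuclideanSpace ℝ (Fin n)) 1 => p.2.1)
        (atTop ×ˢ 𝓝 (‖x‖, θ₀)) (𝓝 ‖x‖) :=
      (continuous_fst.tendsto (‖x‖, θ₀)).comp tendsto_snd
    have hθ : Tendsto (fun p : ℕ × ℝ × sphere (0 : EuclideanSpace ℝ (Fin n)) 1 =>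
        (p.2.2 : EuclideanSpace ℝ (Fin n))) (atTop ×ˢ 𝓝 (‖x‖, θ₀)) (𝓝 (θ₀ : _)) :=
      ((continuous_subtype_val.comp continuous_snd).tendsto (‖x‖, θ₀)).comp tendsto_snd
    have hpt := tendsto_fst.prodMk (hρ.smul hθ)
    rw [hrθ] at hpt
    exact (hρ.rpow_const (Or.inl hr.ne')).mul
      (((((hgrad.tendsto_prod hgrad₀.continuousAt).comp hpt).inner hθ).sub
        ((((hv.tendsto_prod hv₀.continuousAt).comp hpt).const_mul α).div hρ hr.ne')).pow 2)
  obtain ⟨pa, hpa, pb, hpb, hψ⟩ := eventually_prod_iff.1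
    (hlim.eventually_const_lt (half_lt_self hLpos))
  obtain ⟨U, hU, V, hV, hUV⟩ := mem_nhds_prod_iff.1 hpb
  obtain ⟨ε, hε, hball⟩ := Metric.mem_nhds_iff.1 hU
  set b := ‖x‖ + ε / 2 with hb
  have hab : ‖x‖ < b := by linarith
  have hUsub : ∀ ρ ∈ Icc ‖x‖ b, ρ ∈ U := fun ρ hρ => hball (by
    rw [mem_ball, Real.dist_eq, abs_lt]
    constructor <;> linarith [hρ.1, hρ.2])
  have hVpos : 0 < (volume : Measure (EuclideanSpace ℝ (Fin n))).toSphere.real V :=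
    ENNReal.toReal_pos (Measure.measure_pos_of_mem_nhds _ hV).ne' (measure_ne_top _ _)
  have hδ : 0 < (b - ‖x‖) *
      (L / 2 * (volume : Measure (EuclideanSpace ℝ (Fin n))).toSphere.real V) :=
    mul_pos (by linarith) (mul_pos (by linarith) hVpos)
  obtain ⟨m, hm1, ⟨hm2, hm3⟩, hm4⟩ :=
    (hpa.and ((hcont b).and (hdefect ‖x‖ b hr hab _ hδ))).exists
  refine hm4.not_ge ?_
  have hcontψ : ContinuousOn (Function.uncurry (ψ m)) (Icc ‖x‖ b ×ˢ univ) := by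
    have hρ0 : ∀ p ∈ Icc ‖x‖ b ×ˢ (univ : Set (sphere (0 : EuclideanSpace ℝ (Fin n)) 1)),
        p.1 ≠ 0 := fun p hp => (hr.trans_le hp.1.1).ne'
    have hmaps : MapsTo (fun p : ℝ × sphere (0 : EuclideanSpace ℝ (Fin n)) 1 =>
        p.1 • (p.2 : EuclideanSpace ℝ (Fin n))) (Icc ‖x‖ b ×ˢ univ) (closedBall 0 b) := by
      intro p hp
      have h0 : 0 ≤ p.1 := hr.le.trans hp.1.1
      simpa [norm_smul, abs_of_nonneg h0] using hp.1.2
    have hθ : Continuous fun p : ℝ × sphere (0 : EuclideanSpace ℝ (Fin n)) 1 =>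
        (p.2 : EuclideanSpace ℝ (Fin n)) := continuous_subtype_val.comp continuous_snd
    have hpt : ContinuousOn (fun p : ℝ × sphere (0 : EuclideanSpace ℝ (Fin n)) 1 =>
        p.1 • (p.2 : EuclideanSpace ℝ (Fin n))) (Icc ‖x‖ b ×ˢ univ) :=
      (continuous_fst.smul hθ).continuousOn
    exact (continuousOn_fst.rpow_const fun p hp => Or.inl (hρ0 p hp)).mul
      ((((hm3.comp hpt hmaps).inner hθ.continuousOn).sub
        ((continuousOn_const.mul (hm2.comp hpt hmaps)).div continuousOn_fst hρ0)).pow 2)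
  have hmain := mul_measureReal_le_intervalIntegral_integral
    (volume : Measure (EuclideanSpace ℝ (Fin n))).toSphere hab.le hcontψ
    (fun ρ hρ θ => mul_nonneg (Real.rpow_nonneg (hr.le.trans hρ.1) _) (sq_nonneg _))
    (half_pos hLpos).le (fun ρ hρ θ hθ => (hψ hm1 (hUV (mk_mem_prod (hUsub ρ hρ) hθ))).le)
  simpa only [ψ, sphInt, integral_const_mul] using hmain

/-- Theorem 1 of the paper: under minimality against the α-homogeneous
competitor, uniform `C^{1,β}` bounds on the rescalings, and the monotonicity/increment
estimates for the Weiss-type quantity `A`, every sequence `R_i ↓ 0` admits a subsequence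
along which the rescalings `u_{R_i}` converge in `C¹_loc` to a blow-up `u₀` which is
either homogeneous of degree `α` or identically zero. -/
theorem blowups_are_homogeneous {n : ℕ} (hn : 2 ≤ n) {β α R₀ : ℝ}
    (hβ : β ∈ Set.Ioo (0 : ℝ) 1) (hα : α = 1 + β) (hR₀ : 0 < R₀)
    (u : EuclideanSpace ℝ (Fin n) → ℝ)
    (hu : ContDiffOn ℝ 1 u (ball (0 : EuclideanSpace ℝ (Fin n)) R₀))
    (hu0 : u 0 = 0) (hgrad0 : gradient u 0 = 0)
    -- (i): minimality against the α-homogeneous extension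
    (hmin : ∀ R ∈ Set.Ioo (0 : ℝ) R₀,
      (∫ x in ball (0 : EuclideanSpace ℝ (Fin n)) R, ‖gradient u x‖ ^ 2) ≤
        ∫ x in ball (0 : EuclideanSpace ℝ (Fin n)) R, ‖gradient (homExt n α R u) x‖ ^ 2)
    -- (ii): uniform local C^{1,β} bounds on the rescalings u_R
    (hC1β : ∀ K : Set (EuclideanSpace ℝ (Fin n)), IsCompact K →
      ∃ C > (0 : ℝ), ∃ RK > (0 : ℝ), ∀ R ∈ Set.Ioo (0 : ℝ) (min RK (R₀ / 2)),
        (∀ x ∈ K, |rescale n α u R x| ≤ C) ∧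
        (∀ x ∈ K, ‖gradient (rescale n α u R) x‖ ≤ C) ∧
        (∀ x ∈ K, ∀ y ∈ K,
          ‖gradient (rescale n α u R) x - gradient (rescale n α u R) y‖ ≤ C * ‖x - y‖ ^ β))
    -- (iii): monotonicity of A and the increment estimate
    (hmono : MonotoneOn (Afun n α u) (Set.Ioo (0 : ℝ) R₀))
    (hincr : ∀ s₁ s₂ : ℝ, 0 < s₁ → s₁ < s₂ → ∀ R : ℝ, 0 < R → s₂ * R < R₀ →
      (∫ ρ in s₁..s₂, ρ ^ (-(1 + 2 * (α - 1))) * sphInt n (fun θ =>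
          (⟪gradient (rescale n α u R) (ρ • θ), θ⟫ - α * rescale n α u R (ρ • θ) / ρ) ^ 2)) ≤
        Afun n α u (s₂ * R) - Afun n α u (s₁ * R)) :
    ∀ Ri : ℕ → ℝ, (∀ i, Ri i ∈ Set.Ioo (0 : ℝ) R₀) → StrictAnti Ri →
      Tendsto Ri atTop (nhds 0) →
      ∃ σ : ℕ → ℕ, StrictMono σ ∧ ∃ u₀ : EuclideanSpace ℝ (Fin n) → ℝ,
        TendstoLocallyUniformly (fun m => rescale n α u (Ri (σ m))) u₀ atTop ∧
        TendstoLocallyUniformly (fun m => gradient (rescale n α u (Ri (σ m))))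
          (gradient u₀) atTop ∧
        ((∀ x : EuclideanSpace ℝ (Fin n), ∀ t : ℝ, 0 < t → u₀ (t • x) = t ^ α * u₀ x) ∨
          u₀ = 0) := by
  intro Ri hRi _ hRi0
  have hud : DifferentiableOn ℝ u (ball 0 R₀) := hu.differentiableOn one_ne_zero
  have hβ0 : 0 < β := hβ.1
  have hα0 : 0 < α := by linarith
  have hpos : ∀ k, 0 < Ri k := fun k => (hRi k).1
  have hsmall : ∀ r : ℝ, ∀ᶠ k in atTop, r * Ri k < R₀ := fun r => by
    have h : Tendsto (fun k => r * Ri k) atTop (𝓝 0) := by simpa using hRi0.const_mul r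
    exact h.eventually_lt_const hR₀
  have hbounds : ∀ r : ℝ, ∃ C : ℝ, ∀ᶠ k in atTop,
      ∀ x ∈ closedBall (0 : EuclideanSpace ℝ (Fin n)) r,
        DifferentiableAt ℝ (rescale n α u (Ri k)) x ∧ |rescale n α u (Ri k) x| ≤ C ∧
        ‖gradient (rescale n α u (Ri k)) x‖ ≤ C ∧
        ∀ y ∈ closedBall (0 : EuclideanSpace ℝ (Fin n)) r,
          ‖gradient (rescale n α u (Ri k)) x - gradient (rescale n α u (Ri k)) y‖ ≤
            C * ‖x - y‖ ^ β := by
    intro r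
    obtain ⟨C, -, RK, hRK, hC⟩ := hC1β _ (isCompact_closedBall 0 r)
    refine ⟨C, ?_⟩
    filter_upwards [hsmall r, hRi0.eventually_lt_const (lt_min hRK (half_pos hR₀))]
      with k hk1 hk2 x hx
    obtain ⟨h1, h2, h3⟩ := hC _ ⟨hpos k, hk2⟩
    refine ⟨differentiableAt_rescale hud (hpos k) (lt_of_le_of_lt ?_ hk1), h1 x hx, h2 x hx,
      h3 x hx⟩
    rw [mul_comm]
    exact mul_le_mul_of_nonneg_right (mem_closedBall_zero_iff.1 hx) (hpos k).le
  obtain ⟨σ, hσ, u₀, hu₀c, hu₀g, hu₀d, hconv, hconvg⟩ :=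
    exists_subseq_tendstoLocallyUniformly_gradient hβ0 hbounds
  refine ⟨σ, hσ, u₀, hconv, hconvg, Or.inl ?_⟩
  have hcont : ∀ r : ℝ, ∀ᶠ m in atTop,
      ContinuousOn (rescale n α u (Ri (σ m))) (closedBall 0 r) ∧
      ContinuousOn (gradient (rescale n α u (Ri (σ m)))) (closedBall 0 r) := fun r => by
    obtain ⟨C, hC⟩ := hbounds r
    filter_upwards [hσ.tendsto_atTop.eventually hC] with m hm
    exact ⟨fun x hx => (hm x hx).1.continuousAt.continuousWithinAt,
      continuousOn_of_norm_sub_le_mul_rpow hβ0 fun x hx => (hm x hx).2.2.2⟩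
  obtain ⟨C, -, RK, hRK, hC⟩ := hC1β _ (isCompact_closedBall 0 1)
  have hdefect : ∀ s t : ℝ, 0 < s → s < t → ∀ ε > 0, ∀ᶠ m in atTop,
      (∫ ρ in s..t, ρ ^ (-(1 + 2 * (α - 1))) * sphInt n (fun θ =>
        (⟪gradient (rescale n α u (Ri (σ m))) (ρ • θ), θ⟫ -
          α * rescale n α u (Ri (σ m)) (ρ • θ) / ρ) ^ 2)) < ε := by
    intro s t hs hst ε hε
    have hlim := (hmono.tendsto_sub_comp_mul hR₀ (lt_min hRK (half_pos hR₀))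
      (fun R hR => neg_le_Afun hα0.le hR.1 (hC R hR).1) hpos hRi0 hs
      (hs.trans hst)).comp hσ.tendsto_atTop
    filter_upwards [hlim.eventually_lt_const hε, hσ.tendsto_atTop.eventually (hsmall t)]
      with m hm1 hm2
    exact (hincr s t hs hst _ (hpos _) hm2).trans_lt hm1
  intro x t ht
  rcases eq_or_ne x 0 with rfl | hx
  · have hzero : u₀ 0 = 0 := by
      refine tendsto_nhds_unique (hconv.tendstoLocallyUniformlyOn.tendsto_at (mem_univ 0)) ?_
      simp [rescale, hu0]
    simp [hzero]
  · exact homogeneous_of_inner_gradient_eq (fun y => (hu₀d y).hasGradientAt)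
      (fun y hy => inner_gradient_eq_of_tendsto_defect hconv hconvg hu₀c hu₀g hcont hdefect hy)
      hx ht
end
end
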